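/- Let K, H ≥ 1, γ ∈ (0,1), κ = 1/γ − 1, W_a ∈ ℝ^{K×K}, W_A ∈ ℝ^{K×H}, c ∈ ℝ^K, h₀ ∈ ℝ^H. Define p₀ = σ₁(W_a W_A h₀ + c) ∈ ℝ^K, where σ₁ is the softmax, and J₀ = p₀p₀ᵀ − Diag(p₀). If W_a satisfies the fixed-point condition κ J₀² W_a (W_A W_Aᵀ) + W_a = I, then the map g : ℝ^H → ℝ^K, g(h) = σ₁(W_a W_A h + c), is differentiable at h₀, its Jacobian matrix at h₀ equals (Diag(p₀) − p₀p₀ᵀ) W_a W_A, and the Frobenius norm of this Jacobian is at most √(γK/(2(1−γ))). -/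

import Mathlib

open Matrix

/-- Softmax: `σ₁(z)_k = exp(z_k) / ∑_j exp(z_j)`. -/
noncomputable def softmax {K : ℕ} (z : Fin K → ℝ) : Fin K → ℝ :=
  fun k => Real.exp (z k) / ∑ j, Real.exp (z j)

/-- Squared Frobenius norm of a real matrix. -/
def frobSq {m n : Type*} [Fintype m] [Fintype n] (M : Matrix m n ℝ) : ℝ :=
  ∑ i, ∑ j, (M i j) ^ 2

/-- The Jacobian of softmax at `z` is `Diag(p) - p pᵀ` with `p = softmax z`. -/
theorem hasFDerivAt_softmax {K : ℕ} (hK : 1 ≤ K) (z : Fin K → ℝ) :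
    HasFDerivAt softmax
      (LinearMap.toContinuousLinearMap (Matrix.mulVecLin
        (Matrix.diagonal (softmax z) - Matrix.vecMulVec (softmax z) (softmax z)))) z := by
  have : Nonempty (Fin K) := ⟨⟨0, hK⟩⟩
  have hpos : 0 < ∑ j, Real.exp (z j) :=
    Finset.sum_pos (fun j _ => Real.exp_pos _) Finset.univ_nonempty
  rw [hasFDerivAt_pi']
  intro k
  have hexp : ∀ j, HasFDerivAt (fun x : Fin K → ℝ => Real.exp (x j))
      (Real.exp (z j) • ContinuousLinearMap.proj (R := ℝ) (φ := fun _ : Fin K => ℝ) j) z :=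
    fun j => (hasFDerivAt_apply j z).exp
  have hsum : HasFDerivAt (fun x : Fin K → ℝ => ∑ j, Real.exp (x j))
      (∑ j, Real.exp (z j) • ContinuousLinearMap.proj (R := ℝ) (φ := fun _ : Fin K => ℝ) j) z :=
    HasFDerivAt.fun_sum fun j _ => hexp j
  have hinv := (hasDerivAt_inv hpos.ne').comp_hasFDerivAt z hsum
  refine ((hexp k).mul hinv).congr_fderiv ?_
  ext v
  have hdot : softmax z ⬝ᵥ v = (∑ j, Real.exp (z j) * v j) / ∑ j, Real.exp (z j) := by
    simp only [dotProduct, softmax, Finset.sum_div, div_mul_eq_mul_div]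
  simp [Matrix.mulVec_diagonal, Matrix.vecMulVec_mulVec, hdot]
  simp only [softmax]
  field_simp
  ring

/-- The squared Frobenius norm is `tr(Mᵀ M)`. -/
theorem frobSq_eq_trace {m n : Type*} [Fintype m] [Fintype n] (M : Matrix m n ℝ) :
    frobSq M = (Mᵀ * M).trace := by
  simp only [frobSq, Matrix.trace, Matrix.diag, Matrix.mul_apply, Matrix.transpose_apply, sq]
  exact Finset.sum_comm

/-- `tr W - ‖W‖_F²` is at most a quarter of the dimension. -/
theorem trace_sub_frobSq_le {n : Type*} [Fintype n] (W : Matrix n n ℝ) :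
    W.trace - frobSq W ≤ Fintype.card n / 4 := by
  rw [Matrix.trace, frobSq, ← Finset.sum_sub_distrib]
  calc ∑ i, (W.diag i - ∑ j, W i j ^ 2) ≤ ∑ _i : n, (1 / 4 : ℝ) := by
        refine Finset.sum_le_sum fun i _ => ?_
        have h := Finset.single_le_sum (f := fun j => W i j ^ 2)
          (fun j _ => sq_nonneg _) (Finset.mem_univ i)
        simp only [Matrix.diag_apply]
        nlinarith [sq_nonneg (W i i - 1 / 2)]
    _ = Fintype.card n / 4 := by
        simp [div_eq_mul_inv]

/-- A solution `W` of `κ S² W (A Aᵀ) + W = 1` with `S` symmetric satisfies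
`κ ‖S W A‖_F² = tr W - ‖W‖_F²`. -/
theorem mul_frobSq_eq_trace_sub_frobSq {m n : Type*} [Fintype m] [Fintype n] [DecidableEq m]
    {κ : ℝ} {S W : Matrix m m ℝ} {A : Matrix m n ℝ} (hS : Sᵀ = S)
    (heq : κ • (S * S * W * (A * Aᵀ)) + W = 1) :
    κ * frobSq (S * W * A) = W.trace - frobSq W := by
  have h := congrArg (fun M => (Wᵀ * M).trace) heq
  simp only [Matrix.mul_add, Matrix.mul_smul, Matrix.trace_add, Matrix.trace_smul, smul_eq_mul,
    Matrix.mul_one, Matrix.trace_transpose, ← frobSq_eq_trace] at h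
  have hfrob : frobSq (S * W * A) = (Wᵀ * (S * S * W * (A * Aᵀ))).trace := by
    rw [frobSq_eq_trace, Matrix.transpose_mul, Matrix.transpose_mul, hS, Matrix.mul_assoc,
      Matrix.trace_mul_comm]
    simp only [Matrix.mul_assoc]
  rw [hfrob]
  linarith

theorem calibrated_fused_jacobian_bound (K H : ℕ) (hK : 1 ≤ K) (hH : 1 ≤ H)
    (γ : ℝ) (hγ0 : 0 < γ) (hγ1 : γ < 1) (κ : ℝ) (hκ : κ = 1 / γ - 1)
    (Wa : Matrix (Fin K) (Fin K) ℝ) (WA : Matrix (Fin K) (Fin H) ℝ)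
    (c : Fin K → ℝ) (h₀ : Fin H → ℝ)
    (p₀ : Fin K → ℝ) (hp₀ : p₀ = softmax ((Wa * WA).mulVec h₀ + c))
    (J₀ : Matrix (Fin K) (Fin K) ℝ)
    (hJ₀ : J₀ = Matrix.vecMulVec p₀ p₀ - Matrix.diagonal p₀)
    (heq : κ • (J₀ * J₀ * Wa * (WA * WAᵀ)) + Wa = 1) :
    HasFDerivAt (fun h : Fin H → ℝ => softmax ((Wa * WA).mulVec h + c))
      (LinearMap.toContinuousLinearMap
        (Matrix.mulVecLin ((Matrix.diagonal p₀ - Matrix.vecMulVec p₀ p₀) * Wa * WA))) h₀ ∧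
    Real.sqrt (frobSq ((Matrix.diagonal p₀ - Matrix.vecMulVec p₀ p₀) * Wa * WA)) ≤
      Real.sqrt (γ * K / (2 * (1 - γ))) := by
  constructor
  · have hlin : HasFDerivAt (fun h : Fin H → ℝ => (Wa * WA).mulVec h + c)
        (LinearMap.toContinuousLinearMap (Matrix.mulVecLin (Wa * WA))) h₀ :=
      (LinearMap.toContinuousLinearMap (Matrix.mulVecLin (Wa * WA))).hasFDerivAt.add_const c
    refine ((hasFDerivAt_softmax hK _).comp h₀ hlin).congr_fderiv ?_
    rw [← hp₀, Matrix.mul_assoc, Matrix.mulVecLin_mul _ (Wa * WA)]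
    rfl
  · set S := Matrix.diagonal p₀ - Matrix.vecMulVec p₀ p₀ with hS
    have hJS : J₀ = -S := by rw [hJ₀, hS, neg_sub]
    have hSt : Sᵀ = S := by
      rw [hS, Matrix.transpose_sub, Matrix.diagonal_transpose, Matrix.transpose_vecMulVec]
    rw [hJS, neg_mul_neg] at heq
    have hkey := mul_frobSq_eq_trace_sub_frobSq hSt heq
    have hle := trace_sub_frobSq_le Wa
    rw [Fintype.card_fin] at hle
    have hγ : 0 < 1 - γ := sub_pos.mpr hγ1
    have hκγ : κ * γ = 1 - γ := by
      rw [hκ]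
      field_simp
    apply Real.sqrt_le_sqrt
    rw [le_div_iff₀ (by positivity)]
    calc frobSq (S * Wa * WA) * (2 * (1 - γ))
        = 2 * γ * (κ * frobSq (S * Wa * WA)) := by rw [← hκγ]; ring
      _ ≤ 2 * γ * (K / 4) := by rw [hkey]; gcongr
      _ ≤ γ * K := by nlinarith [mul_nonneg hγ0.le (Nat.cast_nonneg (α := ℝ) K)]
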